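/- For every s > 1 there exists a constant c_s > 0 such that for every n ≥ 2 and every collection of n pairwise non-parallel lines ℓ₁, …, ℓₙ in ℝ² with (1/n)-neighborhoods T₁, …, Tₙ, one has Σ_{i≠j, 1≤i,j≤n} |T_i ∩ T_j|^s ≥ c_s · n^{1−s}. -/

import Mathlib

open MeasureTheory Finset

/-- A line in the plane: the set of points `p + t • v` with `v ≠ 0`. -/
def IsLine (L : Set (EuclideanSpace ℝ (Fin 2))) : Prop :=
  ∃ p v : EuclideanSpace ℝ (Fin 2), v ≠ 0 ∧ L = {x | ∃ t : ℝ, x = p + t • v}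

/-- The `r`-neighborhood of a set in the plane. -/
def lineNbhd (L : Set (EuclideanSpace ℝ (Fin 2))) (r : ℝ) : Set (EuclideanSpace ℝ (Fin 2)) :=
  {x | Metric.infDist x L ≤ r}

/-- The line with unit normal `(cos θ, sin θ)` and offset `a`. -/
def normalLine (θ a : ℝ) : Set (EuclideanSpace ℝ (Fin 2)) :=
  {x | Real.cos θ * x 0 + Real.sin θ * x 1 = a}

lemma IsLine.exists_eq_normalLine {L : Set (EuclideanSpace ℝ (Fin 2))} (hL : IsLine L) :
    ∃ θ a : ℝ, θ ∈ Set.Ioc (-Real.pi) Real.pi ∧ L = normalLine θ a := by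
  obtain ⟨p, v, hv, rfl⟩ := hL
  set z : ℂ := ⟨-v 1, v 0⟩ with hz
  have hvv : v 0 ≠ 0 ∨ v 1 ≠ 0 := by
    by_contra! h
    apply hv
    ext i
    fin_cases i <;> simp [h.1, h.2]
  have hz0 : z ≠ 0 := by
    intro h
    have h1 := congrArg Complex.re h
    have h2 := congrArg Complex.im h
    simp only [hz, Complex.zero_re, Complex.zero_im, neg_eq_zero] at h1 h2
    tauto
  have hn : ‖z‖ ≠ 0 := norm_ne_zero_iff.mpr hz0
  have hc : ‖z‖ * Real.cos z.arg = -v 1 := Complex.norm_mul_cos_arg z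
  have hs : ‖z‖ * Real.sin z.arg = v 0 := Complex.norm_mul_sin_arg z
  refine ⟨z.arg, Real.cos z.arg * p 0 + Real.sin z.arg * p 1, Complex.arg_mem_Ioc z, ?_⟩
  ext x
  simp only [normalLine, Set.mem_ofPred_eq]
  constructor
  · rintro ⟨t, rfl⟩
    apply mul_left_cancel₀ hn
    simp only [PiLp.add_apply, PiLp.smul_apply, smul_eq_mul]
    linear_combination (t * v 0) * hc + (t * v 1) * hs
  · intro h
    have hq : v 0 ^ 2 + v 1 ^ 2 ≠ 0 := by
      rcases hvv with h | h <;> positivity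
    have key : -v 1 * (x 0 - p 0) + v 0 * (x 1 - p 1) = 0 := by
      linear_combination ‖z‖ * h - (x 0 - p 0) * hc - (x 1 - p 1) * hs
    refine ⟨((x 0 - p 0) * v 0 + (x 1 - p 1) * v 1) / (v 0 ^ 2 + v 1 ^ 2), ?_⟩
    ext i
    fin_cases i
    · simp only [Fin.zero_eta, PiLp.add_apply, PiLp.smul_apply, smul_eq_mul]
      field_simp
      linear_combination (-v 1) * key
    · simp only [Fin.mk_one, PiLp.add_apply, PiLp.smul_apply, smul_eq_mul]
      field_simp
      linear_combination (v 0) * key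

lemma infDist_normalLine (θ a : ℝ) (x : EuclideanSpace ℝ (Fin 2)) :
    Metric.infDist x (normalLine θ a) = |Real.cos θ * x 0 + Real.sin θ * x 1 - a| := by
  set d : ℝ := Real.cos θ * x 0 + Real.sin θ * x 1 - a with hd
  have hsc := Real.sin_sq_add_cos_sq θ
  set y : EuclideanSpace ℝ (Fin 2) := !₂[x 0 - d * Real.cos θ, x 1 - d * Real.sin θ] with hy
  have hmem : y ∈ normalLine θ a := by
    simp only [normalLine, Set.mem_ofPred_eq, hy, Matrix.cons_val_zero,
      Matrix.cons_val_one]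
    linear_combination (-d) * hsc - hd
  apply le_antisymm
  · refine (Metric.infDist_le_dist_of_mem hmem).trans_eq ?_
    rw [EuclideanSpace.dist_eq, ← Real.sqrt_sq_eq_abs]
    congr 1
    simp only [Fin.sum_univ_two, hy, Real.dist_eq, sq_abs,
      Matrix.cons_val_zero, Matrix.cons_val_one]
    linear_combination d ^ 2 * hsc
  · refine (Metric.le_infDist ⟨y, hmem⟩).mpr fun w hw => ?_
    rw [EuclideanSpace.dist_eq]
    apply Real.abs_le_sqrt
    simp only [normalLine, Set.mem_ofPred_eq] at hw
    simp only [Fin.sum_univ_two, Real.dist_eq, sq_abs]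
    have hdw : d = Real.cos θ * (x 0 - w 0) + Real.sin θ * (x 1 - w 1) := by
      rw [hd, ← hw]; ring
    rw [hdw]
    have := sq_nonneg (Real.cos θ * (x 1 - w 1) - Real.sin θ * (x 0 - w 0))
    linear_combination this + ((x 0 - w 0) ^ 2 + (x 1 - w 1) ^ 2) * hsc

lemma volume_box (a b r : ℝ) :
    volume {x : EuclideanSpace ℝ (Fin 2) | |x 0 - a| ≤ r ∧ |x 1 - b| ≤ r} =
      ENNReal.ofReal (2 * r) * ENNReal.ofReal (2 * r) := by
  have hset : {x : EuclideanSpace ℝ (Fin 2) | |x 0 - a| ≤ r ∧ |x 1 - b| ≤ r} =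
      (WithLp.ofLp : EuclideanSpace ℝ (Fin 2) → Fin 2 → ℝ) ⁻¹'
        Set.Icc ![a - r, b - r] ![a + r, b + r] := by
    ext x
    simp only [Set.mem_ofPred_eq, Set.mem_preimage, Set.mem_Icc, Pi.le_def, Fin.forall_fin_two,
      Matrix.cons_val_zero, Matrix.cons_val_one, abs_le]
    constructor
    · rintro ⟨⟨h1, h2⟩, h3, h4⟩
      refine ⟨⟨?_, ?_⟩, ?_, ?_⟩ <;> linarith
    · rintro ⟨⟨h1, h2⟩, h3, h4⟩
      refine ⟨⟨?_, ?_⟩, ?_, ?_⟩ <;> linarith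
  rw [hset, (PiLp.volume_preserving_ofLp (Fin 2)).measure_preimage
    measurableSet_Icc.nullMeasurableSet, Real.volume_Icc_pi]
  simp only [Fin.prod_univ_two, Matrix.cons_val_zero, Matrix.cons_val_one]
  ring_nf

lemma volume_inter_normalLine {θ φ : ℝ} (a b : ℝ) {r : ℝ} (hr : 0 ≤ r)
    (h : Real.sin (φ - θ) ≠ 0) :
    (volume (lineNbhd (normalLine θ a) r ∩ lineNbhd (normalLine φ b) r)).toReal =
      (2 * r) ^ 2 / |Real.sin (φ - θ)| := by
  set M : Matrix (Fin 2) (Fin 2) ℝ := !![Real.cos θ, Real.sin θ; Real.cos φ, Real.sin φ] with hM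
  set f : EuclideanSpace ℝ (Fin 2) →ₗ[ℝ] EuclideanSpace ℝ (Fin 2) :=
    Matrix.toLin (PiLp.basisFun 2 ℝ (Fin 2)) (PiLp.basisFun 2 ℝ (Fin 2)) M with hf
  have hdet : LinearMap.det f = Real.sin (φ - θ) := by
    rw [hf, LinearMap.det_toLin, hM, Matrix.det_fin_two_of, Real.sin_sub]
    ring
  have hset : lineNbhd (normalLine θ a) r ∩ lineNbhd (normalLine φ b) r =
      f ⁻¹' {x : EuclideanSpace ℝ (Fin 2) | |x 0 - a| ≤ r ∧ |x 1 - b| ≤ r} := by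
    ext x
    simp [lineNbhd, infDist_normalLine, hf, hM, Matrix.toLin_apply, Matrix.mulVec,
      Fin.sum_univ_two, dotProduct]
  rw [hset, Measure.addHaar_preimage_linearMap volume (by rwa [hdet]), hdet, volume_box]
  rw [abs_inv]
  simp only [ENNReal.toReal_mul, ENNReal.toReal_ofReal (inv_nonneg.mpr (abs_nonneg _)),
    ENNReal.toReal_ofReal (mul_nonneg zero_le_two hr)]
  ring

lemma sin_sub_ne_zero_of_existsUnique {θ φ a b : ℝ}
    (h : ∃! x, x ∈ normalLine θ a ∩ normalLine φ b) : Real.sin (φ - θ) ≠ 0 := by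
  obtain ⟨x, ⟨hx1, hx2⟩, hu⟩ := h
  intro h0
  rw [Real.sin_sub] at h0
  simp only [normalLine, Set.mem_ofPred_eq] at hx1 hx2
  have hy := hu !₂[x 0 - Real.sin θ, x 1 + Real.cos θ] (by
    simp only [normalLine, Set.mem_inter_iff, Set.mem_ofPred_eq,
      Matrix.cons_val_zero, Matrix.cons_val_one]
    constructor
    · linear_combination hx1
    · linear_combination hx2 + h0)
  have e0 : x 0 - Real.sin θ = x 0 := by simpa using congrArg (fun w => w 0) hy
  have e1 : x 1 + Real.cos θ = x 1 := by simpa using congrArg (fun w => w 1) hy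
  have hs : Real.sin θ = 0 := by linarith
  have hc : Real.cos θ = 0 := by linarith
  simpa [hs, hc] using Real.sin_sq_add_cos_sq θ

lemma card_le_card_offDiag_collisions {n m : ℕ} (hm : 0 < m) (h : 2 * m ≤ n) (k : Fin n → Fin m) :
    n ≤ #{ij ∈ (univ : Finset (Fin n)).offDiag | k ij.1 = k ij.2} := by
  have hfib : ∑ t, #{i | k i = t} = n := by
    rw [← card_eq_sum_card_fiberwise fun _ _ => mem_coe.mpr (mem_univ _)]
    simp
  have hcs := sq_sum_le_card_mul_sum_sq (s := (univ : Finset (Fin m)))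
    (f := fun t => #{i | k i = t})
  rw [hfib, card_univ, Fintype.card_fin] at hcs
  have hsq : ∑ t, #{i | k i = t} ^ 2 = #{ij : Fin n × Fin n | k ij.1 = k ij.2} := by
    rw [card_eq_sum_card_fiberwise (f := fun ij : Fin n × Fin n => k ij.1) (t := univ)
      fun _ _ => mem_coe.mpr (mem_univ _)]
    refine sum_congr rfl fun t _ => ?_
    rw [sq, ← card_product]
    congr 1
    ext ⟨i, j⟩
    simp only [mem_product, mem_filter, mem_univ, true_and]
    grind
  have hsplit : #{ij : Fin n × Fin n | k ij.1 = k ij.2} ≤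
      #{ij ∈ (univ : Finset (Fin n)).offDiag | k ij.1 = k ij.2} + n := by
    calc _ ≤ #({ij ∈ (univ : Finset (Fin n)).offDiag | k ij.1 = k ij.2} ∪
          (univ : Finset (Fin n)).diag) := by
          apply card_le_card
          rintro ⟨i, j⟩ hij
          simp only [mem_union, mem_filter, mem_offDiag, mem_diag, mem_univ, true_and] at hij ⊢
          tauto
      _ ≤ _ := (card_union_le _ _).trans_eq (by simp)
  rw [hsq] at hcs
  nlinarith

/-- Angles in the same cell of a partition of `[-π, 8 - π)` into `m` equal intervals have
close values. -/
lemma exists_cell_map {ι : Type*} {m : ℕ} (hm : 0 < m) (θ : ι → ℝ)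
    (hθ : ∀ i, θ i ∈ Set.Ioc (-Real.pi) Real.pi) :
    ∃ k : ι → Fin m, ∀ i j, k i = k j → |θ j - θ i| ≤ 8 / m := by
  have hm' : (0 : ℝ) < m := Nat.cast_pos.mpr hm
  have hnn : ∀ i, 0 ≤ (θ i + Real.pi) / 8 * m := fun i => by
    have := (hθ i).1
    have : 0 ≤ θ i + Real.pi := by linarith
    positivity
  refine ⟨fun i => ⟨⌊(θ i + Real.pi) / 8 * m⌋₊, (Nat.floor_lt (hnn i)).mpr ?_⟩, fun i j hij => ?_⟩
  · have h1 := (hθ i).2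
    have h2 := Real.pi_lt_four
    have h3 : (θ i + Real.pi) / 8 < 1 := by linarith
    nlinarith
  · have hij' := congrArg Fin.val hij
    simp only at hij'
    have i1 := Nat.floor_le (hnn i)
    have i2 := Nat.lt_floor_add_one ((θ i + Real.pi) / 8 * m)
    have j1 := Nat.floor_le (hnn j)
    have j2 := Nat.lt_floor_add_one ((θ j + Real.pi) / 8 * m)
    rw [hij'] at i1 i2
    rw [abs_sub_le_iff, le_div_iff₀ hm', le_div_iff₀ hm']
    constructor <;> linarith


/-- For `s > 1` there is `c_s > 0` such that for any `n ≥ 2` pairwise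
non-parallel lines in `ℝ²` with `(1/n)`-neighborhoods `T₁, …, Tₙ`, one has
`∑_{i ≠ j} |Tᵢ ∩ Tⱼ|^s ≥ c_s n^{1-s}`. -/
theorem overlap_lines_lower_bound_large_s (s : ℝ) (hs : 1 < s) :
    ∃ c : ℝ, 0 < c ∧ ∀ n : ℕ, 2 ≤ n →
      ∀ L : Fin n → Set (EuclideanSpace ℝ (Fin 2)),
        (∀ i, IsLine (L i)) →
        (∀ i j, i ≠ j → ∃! x, x ∈ L i ∩ L j) →
        c * (n : ℝ) ^ ((1 : ℝ) - s) ≤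
          ∑ ij ∈ (Finset.univ : Finset (Fin n)).offDiag,
            (volume (lineNbhd (L ij.1) (1 / n) ∩ lineNbhd (L ij.2) (1 / n))).toReal ^ s := by
  refine ⟨(1 / 6) ^ s, by positivity, fun n hn L hL hu => ?_⟩
  choose θ a hθ hLθ using fun i => (hL i).exists_eq_normalLine
  have hn0 : (0 : ℝ) < n := by positivity
  have hm : 0 < n / 2 := by omega
  have hmn : (n : ℝ) ≤ 3 * (n / 2 : ℕ) := by
    have : n ≤ 3 * (n / 2) := by omega
    exact_mod_cast this
  obtain ⟨k, hk⟩ := exists_cell_map hm θ hθ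
  have hcard := card_le_card_offDiag_collisions hm (by omega) k
  have harea : ∀ ij ∈ {ij ∈ (univ : Finset (Fin n)).offDiag | k ij.1 = k ij.2},
      (1 / 6 / n : ℝ) ^ s ≤
        (volume (lineNbhd (L ij.1) (1 / n) ∩ lineNbhd (L ij.2) (1 / n))).toReal ^ s := by
    rintro ⟨i, j⟩ hij
    simp only [mem_filter, mem_offDiag, mem_univ, true_and] at hij ⊢
    have huij := hu i j hij.1
    rw [hLθ i, hLθ j] at huij ⊢
    have hsin := sin_sub_ne_zero_of_existsUnique huij
    rw [volume_inter_normalLine _ _ (by positivity) hsin]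
    have hle : |Real.sin (θ j - θ i)| ≤ 24 / n := by
      refine (Real.abs_sin_le_abs.trans (hk i j hij.2)).trans ?_
      rw [div_le_div_iff₀ (by exact_mod_cast hm) hn0]
      linarith
    refine Real.rpow_le_rpow (by positivity) ?_ (by linarith)
    calc (1 / 6 / n : ℝ) = (2 * (1 / n)) ^ 2 / (24 / n) := by field_simp; norm_num
      _ ≤ _ := by gcongr
  calc (1 / 6 : ℝ) ^ s * (n : ℝ) ^ (1 - s) = n * (1 / 6 / n : ℝ) ^ s := by
        rw [Real.div_rpow (by norm_num) hn0.le, Real.rpow_sub hn0, Real.rpow_one]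
        ring
    _ ≤ #{ij ∈ (univ : Finset (Fin n)).offDiag | k ij.1 = k ij.2} * (1 / 6 / n : ℝ) ^ s := by
        gcongr
    _ ≤ ∑ ij ∈ (univ : Finset (Fin n)).offDiag with k ij.1 = k ij.2,
          (volume (lineNbhd (L ij.1) (1 / n) ∩ lineNbhd (L ij.2) (1 / n))).toReal ^ s := by
        rw [← nsmul_eq_mul]
        exact card_nsmul_le_sum _ _ _ harea
    _ ≤ _ := sum_le_sum_of_subset_of_nonneg (filter_subset _ _) fun _ _ _ => by positivity
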